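/- The distribution of the coefficients of BExc_n^±(t) (equivalently, of B_n^±(t)) is asymptotically normal as n → ∞. Moreover, for n ≥ 2 the mean of the coefficient distribution of BExc_n^±(t) and of B_n^±(t) equals n/2, and for n ≥ 3 its variance equals (n+1)/12. -/

import Mathlib

open scoped BigOperators


/-- A model of the hyperoctahedral group `B_n`: a signed permutation is a permutation of
`{1,...,n}` together with a sign for each position; `π_i = ±σ(i)`. -/
abbrev BG (n : ℕ) := Equiv.Perm (Fin n) × (Fin n → Bool)

/-- The value `π_{i+1} ∈ {−n,...,−1,1,...,n}` of a signed permutation at (0-indexed) position `i`. -/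
def bval {n : ℕ} (π : BG n) (i : Fin n) : ℤ :=
  (if π.2 i then -1 else 1) * ((π.1 i : ℤ) + 1)

/-- The value `π_i` at 1-indexed position `i ∈ {1,...,n}`, with the convention `π_0 = 0`. -/
def bvalExt {n : ℕ} (π : BG n) (i : ℕ) : ℤ :=
  if h : 1 ≤ i ∧ i ≤ n then bval π ⟨i - 1, by omega⟩ else 0

/-- `des_B(π) = |{i ∈ {0,...,n−1} : π_i > π_{i+1}}|` with `π_0 = 0`. -/
def desB {n : ℕ} (π : BG n) : ℕ :=
  ((Finset.range n).filter (fun i => bvalExt π (i + 1) < bvalExt π i)).card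

/-- `asc_B(π) = n − des_B(π)`. -/
def ascB {n : ℕ} (π : BG n) : ℕ := n - desB π

/-- `negs(π) = |{i ∈ [n] : π_i < 0}|`. -/
def negs {n : ℕ} (π : BG n) : ℕ :=
  (Finset.univ.filter (fun i : Fin n => bval π i < 0)).card

/-- `inv_A(π) = |{1 ≤ i < j ≤ n : π_i > π_j}|` (usual order on `ℤ`). -/
def invAB {n : ℕ} (π : BG n) : ℕ :=
  (Finset.univ.filter (fun p : Fin n × Fin n => p.1 < p.2 ∧ bval π p.2 < bval π p.1)).card

/-- `inv_D(π) = inv_A(π) + |{1 ≤ i < j ≤ n : −π_i > π_j}|`. -/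
def invDB {n : ℕ} (π : BG n) : ℕ :=
  invAB π +
    (Finset.univ.filter (fun p : Fin n × Fin n => p.1 < p.2 ∧ bval π p.2 < -bval π p.1)).card

/-- `inv_B(π) = inv_A(π) + |{1 ≤ i < j ≤ n : −π_i > π_j}| + negs(π)`. -/
def invBB {n : ℕ} (π : BG n) : ℕ := invDB π + negs π

/-- `exc_B(π) = |{i ∈ [n] : π_{|π_i|} > π_i}| + |{i ∈ [n] : π_i = −i}|`. -/
def excB {n : ℕ} (π : BG n) : ℕ :=
  (Finset.univ.filter (fun i : Fin n => bval π i < bvalExt π (bval π i).natAbs)).card +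
    (Finset.univ.filter (fun i : Fin n => bval π i = -((i : ℤ) + 1))).card

/-- The cumulative distribution function of the standard normal distribution. -/
noncomputable def stdNormalCDF (x : ℝ) : ℝ :=
  ∫ t in Set.Iic x, Real.exp (-t ^ 2 / 2) / Real.sqrt (2 * Real.pi)

/-- Row sum `Sum_n = Σ_k s_{n,k}` of a triangular array of counts. -/
noncomputable def rowSum (c : ℕ → ℕ → ℕ) (n : ℕ) : ℝ := ∑' k : ℕ, (c n k : ℝ)

/-- Mean `Σ_k k·s_{n,k}/Sum_n` of row `n`. -/
noncomputable def rowMean (c : ℕ → ℕ → ℕ) (n : ℕ) : ℝ :=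
  (∑' k : ℕ, (k : ℝ) * (c n k : ℝ)) / rowSum c n

/-- Variance `Σ_k k²·s_{n,k}/Sum_n − (mean)²` of row `n`. -/
noncomputable def rowVar (c : ℕ → ℕ → ℕ) (n : ℕ) : ℝ :=
  (∑' k : ℕ, (k : ℝ) ^ 2 * (c n k : ℝ)) / rowSum c n - rowMean c n ^ 2

/-- `Σ_{k ≤ ⌊y⌋} s_{n,k} / Sum_n` (for `k : ℕ`, `k ≤ ⌊y⌋ ↔ (k:ℝ) ≤ y`). -/
noncomputable def rowCDF (c : ℕ → ℕ → ℕ) (n : ℕ) (y : ℝ) : ℝ :=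
  (∑' k : ℕ, if (k : ℝ) ≤ y then (c n k : ℝ) else 0) / rowSum c n

/-- The triangular array `c` is asymptotically normal:
`lim_n sup_x |Σ_{k ≤ ⌊xσ_n + μ_n⌋} s_{n,k}/Sum_n − Φ(x)| = 0`, where `μ_n`, `σ_n²` are
the mean and variance of row `n`. -/
def IsAsympNormal (c : ℕ → ℕ → ℕ) : Prop :=
  Filter.Tendsto
    (fun n => ⨆ x : ℝ,
      |rowCDF c n (x * Real.sqrt (rowVar c n) + rowMean c n) - stdNormalCDF x|)
    Filter.atTop (nhds 0)

/-- Number of `π ∈ B_n^+` with `des_B(π) = k`. -/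
def cBDesP (n k : ℕ) : ℕ :=
  (Finset.univ.filter (fun π : BG n => Even (invBB π) ∧ desB π = k)).card

/-- Number of `π ∈ B_n^-` with `des_B(π) = k`. -/
def cBDesM (n k : ℕ) : ℕ :=
  (Finset.univ.filter (fun π : BG n => ¬ Even (invBB π) ∧ desB π = k)).card

/-- Number of `π ∈ B_n^+` with `exc_B(π) = k`. -/
def cBExcP (n k : ℕ) : ℕ :=
  (Finset.univ.filter (fun π : BG n => Even (invBB π) ∧ excB π = k)).card

/-- Number of `π ∈ B_n^-` with `exc_B(π) = k`. -/
def cBExcM (n k : ℕ) : ℕ :=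
  (Finset.univ.filter (fun π : BG n => ¬ Even (invBB π) ∧ excB π = k)).card

/-- The sign `±1` attached to a negativity bit. -/
def bitSign (b : Bool) : ℝ := if b then -1 else 1

/-- The one-dimensional character `π ↦ (-1) ^ inv_B(π)` of `B_n`, written as the sign of the
underlying permutation times the product of the signs. -/
noncomputable def signWeight {n : ℕ} (π : BG n) : ℝ :=
  ((Equiv.Perm.sign π.1 : ℤ) : ℝ) * ∏ i, bitSign (π.2 i)

/-- Summation of a test function against the type `B` Eulerian numbers. -/
def eulerSum : ℕ → (ℕ → ℝ) → ℝ
  | 0, f => f 0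
  | n + 1, f => eulerSum n fun k => (2 * k + 1) * f k + (2 * ((n : ℝ) - k) + 1) * f (k + 1)

/-- Summation of a test function against the coefficients of `(1 - t) ^ n`. -/
def altSum : ℕ → (ℕ → ℝ) → ℝ
  | 0, f => f 0
  | n + 1, f => altSum n fun k => f k - f (k + 1)

/-- A scheme that builds every element of `B_{n+1}` uniquely by inserting `±(n+1)` into an element
of `B_n`, along which the statistic `st` and the character behave like type `B` descents. -/
structure InsertionScheme (st : ∀ n, BG n → ℕ) where
  /-- insertion of the new largest letter, negated if the bit is set -/
  ins : ∀ n, BG n → Fin (n + 1) → Bool → BG (n + 1)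
  /-- the inner slots at which insertion leaves the statistic unchanged -/
  keeps : ∀ n, BG n → Fin n → Bool
  st_zero : ∀ π, st 0 π = 0
  injective : ∀ n, Function.Injective fun x : BG n × Fin (n + 1) × Bool => ins n x.1 x.2.1 x.2.2
  sum_keeps : ∀ n π, ∑ p, (if keeps n π p then 1 else 0) = st n π
  st_castSucc : ∀ n π p b,
    st (n + 1) (ins n π p.castSucc b) = if keeps n π p then st n π else st n π + 1
  st_last : ∀ n π b, st (n + 1) (ins n π (Fin.last n) b) = if b then st n π + 1 else st n π
  signWeight_true : ∀ n π p, signWeight (ins n π p true) = -signWeight (ins n π p false)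
  signWeight_last : ∀ n π, signWeight (ins n π (Fin.last n) false) = signWeight π

namespace InsertionScheme

variable {st : ∀ n, BG n → ℕ}

theorem sum_eq (S : InsertionScheme st) (n : ℕ) (F : BG (n + 1) → ℝ) :
    ∑ π, F π = ∑ π : BG n, ∑ p : Fin (n + 1), (F (S.ins n π p false) + F (S.ins n π p true)) := by
  have hb : Function.Bijective
      fun x : BG n × Fin (n + 1) × Bool => S.ins n x.1 x.2.1 x.2.2 := by
    rw [Fintype.bijective_iff_injective_and_card]
    refine ⟨S.injective n, ?_⟩
    simp [Fintype.card_prod, Fintype.card_perm, Nat.factorial_succ, pow_succ]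
    ring
  rw [← hb.sum_comp F, Fintype.sum_prod_type]
  simp_rw [Fintype.sum_prod_type, Fintype.sum_bool, add_comm]

theorem sum_st (S : InsertionScheme st) (n : ℕ) (f : ℕ → ℝ) :
    ∑ π : BG n, f (st n π) = eulerSum n f := by
  induction n generalizing f with
  | zero =>
    simp [eulerSum, S.st_zero]
  | succ n ih =>
    rw [S.sum_eq, eulerSum, ← ih]
    refine Finset.sum_congr rfl fun π _ => ?_
    have h (p : Fin n) : f (st (n + 1) (S.ins n π p.castSucc false)) +
        f (st (n + 1) (S.ins n π p.castSucc true)) = 2 * f (st n π + 1) +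
          ((if S.keeps n π p then 1 else 0 : ℕ) : ℝ) * (2 * (f (st n π) - f (st n π + 1))) := by
      rw [S.st_castSucc, S.st_castSucc]
      split_ifs <;> push_cast <;> ring
    rw [Fin.sum_univ_castSucc, Finset.sum_congr rfl fun p _ => h p, Finset.sum_add_distrib,
      ← Finset.sum_mul, ← Finset.sum_mul, ← Nat.cast_sum, S.sum_keeps, S.st_last, S.st_last]
    simp
    ring

theorem sum_signWeight_mul (S : InsertionScheme st) (n : ℕ) (f : ℕ → ℝ) :
    ∑ π : BG n, signWeight π * f (st n π) = altSum n f := by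
  induction n generalizing f with
  | zero =>
    rw [Fintype.sum_subsingleton _ ((1, default) : BG 0)]
    simp [altSum, S.st_zero, signWeight]
  | succ n ih =>
    rw [S.sum_eq, altSum, ← ih]
    refine Finset.sum_congr rfl fun π _ => ?_
    rw [Fin.sum_univ_castSucc, Finset.sum_eq_zero, S.st_last, S.st_last, S.signWeight_true,
      S.signWeight_last]
    · simp
      ring
    · intro p _
      rw [S.st_castSucc, S.st_castSucc, S.signWeight_true]
      ring

end InsertionScheme

theorem prod_pairs_eq {n : ℕ} (f : Fin n → Fin n → ℤ) :
    ∏ p : Fin n × Fin n, (if p.1 < p.2 then f p.1 p.2 else 1) = ∏ i, ∏ j ∈ Finset.Ioi i, f i j := by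
  rw [Fintype.prod_prod_type]
  refine Finset.prod_congr rfl fun i _ => ?_
  rw [← Finset.prod_filter]
  congr 1
  ext j
  simp

theorem neg_one_pow_card_filter {α : Type*} [Fintype α] (P : α → Prop) [DecidablePred P] :
    (-1 : ℤ) ^ (Finset.univ.filter P).card = ∏ a, if P a then -1 else 1 := by
  rw [← Finset.prod_filter, Finset.prod_const]

theorem bval_neg_iff {n : ℕ} (π : BG n) (i : Fin n) : bval π i < 0 ↔ π.2 i = true := by
  unfold bval
  cases π.2 i <;> simp <;> omega

theorem neg_one_pow_invDB {n : ℕ} (π : BG n) :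
    (-1 : ℤ) ^ invDB π = (Equiv.Perm.sign π.1 : ℤ) := by
  rw [invDB, invAB, pow_add, neg_one_pow_card_filter, neg_one_pow_card_filter,
    ← Finset.prod_mul_distrib, Equiv.Perm.sign_eq_prod_prod_Ioi]
  push_cast
  rw [← prod_pairs_eq]
  refine Finset.prod_congr rfl fun p _ => ?_
  by_cases hp : p.1 < p.2
  · have hne : (π.1 p.1 : ℕ) ≠ (π.1 p.2 : ℕ) := fun h =>
      hp.ne (π.1.injective (Fin.ext h))
    simp only [hp, true_and, if_true, bval, Fin.lt_def]
    rcases lt_or_gt_of_ne hne with h | h <;> cases π.2 p.1 <;> cases π.2 p.2 <;>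
      simp <;> split_ifs <;> first | rfl | omega
  · simp [hp]

theorem neg_one_pow_invBB {n : ℕ} (π : BG n) : (-1 : ℝ) ^ invBB π = signWeight π := by
  have h : (-1 : ℤ) ^ negs π = ∏ i, if π.2 i then -1 else 1 := by
    rw [negs, neg_one_pow_card_filter]
    simp_rw [bval_neg_iff]
  have h2 : (-1 : ℤ) ^ invBB π = (Equiv.Perm.sign π.1 : ℤ) * ∏ i, if π.2 i then -1 else 1 := by
    rw [invBB, pow_add, neg_one_pow_invDB, h]
  have := congrArg (Int.cast : ℤ → ℝ) h2
  push_cast at this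
  rw [this, signWeight]
  rfl

/-- Extend a permutation of `Fin n` to `Fin (n + 1)` by placing the new largest value at
position `p`. -/
def extPerm {n : ℕ} (p : Fin (n + 1)) (σ : Equiv.Perm (Fin n)) : Equiv.Perm (Fin (n + 1)) :=
  (finSuccEquiv' p).trans (σ.optionCongr.trans finSuccEquivLast.symm)

theorem extPerm_self {n : ℕ} (p : Fin (n + 1)) (σ : Equiv.Perm (Fin n)) :
    extPerm p σ p = Fin.last n := by
  simp [extPerm]

theorem extPerm_succAbove {n : ℕ} (p : Fin (n + 1)) (σ : Equiv.Perm (Fin n)) (i : Fin n) :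
    extPerm p σ (p.succAbove i) = (σ i).castSucc := by
  simp [extPerm]

theorem extPerm_last_castSucc {n : ℕ} (σ : Equiv.Perm (Fin n)) (i : Fin n) :
    extPerm (Fin.last n) σ i.castSucc = (σ i).castSucc := by
  rw [← Fin.succAbove_last_apply, extPerm_succAbove]

theorem extPerm_injective {n : ℕ} {p q : Fin (n + 1)} {σ τ : Equiv.Perm (Fin n)}
    (h : extPerm p σ = extPerm q τ) : p = q ∧ σ = τ := by
  have hpq : p = q := by
    apply (extPerm q τ).injective
    rw [extPerm_self, ← h, extPerm_self]
  subst hpq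
  refine ⟨rfl, Equiv.ext fun i => ?_⟩
  have := congrArg (fun e : Equiv.Perm (Fin (n + 1)) => e (p.succAbove i)) h
  simpa [extPerm_succAbove] using this

theorem sign_extPerm_last {n : ℕ} (σ : Equiv.Perm (Fin n)) :
    Equiv.Perm.sign (extPerm (Fin.last n) σ) = Equiv.Perm.sign σ := by
  have h : extPerm (Fin.last n) σ =
      (finSuccEquivLast.trans σ.optionCongr).trans finSuccEquivLast.symm := rfl
  rw [h, Equiv.Perm.sign_trans_trans_symm, Equiv.optionCongr_sign]

theorem signWeight_insertNth {n : ℕ} (ρ : Equiv.Perm (Fin (n + 1))) (p : Fin (n + 1)) (b : Bool)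
    (s : Fin n → Bool) :
    signWeight ((ρ, p.insertNth (α := fun _ => Bool) b s) : BG (n + 1)) =
      ((Equiv.Perm.sign ρ : ℤ) : ℝ) * (bitSign b * ∏ i, bitSign (s i)) := by
  rw [signWeight, Fin.prod_univ_succAbove _ p]
  simp

/-! ### Descents -/

/-- Insertion of `±(n+1)` at position `p` of the window of a signed permutation. -/
def windowInsert {n : ℕ} (π : BG n) (p : Fin (n + 1)) (b : Bool) : BG (n + 1) :=
  (extPerm p π.1, p.insertNth (α := fun _ => Bool) b π.2)

theorem windowInsert_injective (n : ℕ) : Function.Injective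
    fun x : BG n × Fin (n + 1) × Bool => windowInsert x.1 x.2.1 x.2.2 := by
  rintro ⟨⟨σ, s⟩, p, b⟩ ⟨⟨τ, t⟩, q, c⟩ h
  simp only [windowInsert, Prod.mk.injEq] at h
  obtain ⟨rfl, rfl⟩ := extPerm_injective h.1
  obtain ⟨rfl, rfl⟩ := Fin.insertNth_inj.1 h.2
  rfl

theorem bval_windowInsert_self {n : ℕ} (π : BG n) (p : Fin (n + 1)) (b : Bool) :
    bval (windowInsert π p b) p = if b then -((n : ℤ) + 1) else n + 1 := by
  cases b <;> simp [bval, windowInsert, extPerm_self]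

theorem bval_windowInsert_succAbove {n : ℕ} (π : BG n) (p : Fin (n + 1)) (b : Bool) (i : Fin n) :
    bval (windowInsert π p b) (p.succAbove i) = bval π i := by
  simp [bval, windowInsert, extPerm_succAbove]

theorem abs_bval_le {n : ℕ} (π : BG n) (i : Fin n) : |bval π i| ≤ n := by
  rw [abs_le, bval]
  have := (π.1 i).isLt
  split_ifs <;> omega

theorem abs_bvalExt_le {n : ℕ} (π : BG n) (j : ℕ) : |bvalExt π j| ≤ n := by
  unfold bvalExt
  split_ifs
  · exact abs_bval_le _ _
  · simp

theorem bvalExt_windowInsert_of_le {n : ℕ} (π : BG n) (p : Fin (n + 1)) (b : Bool) {j : ℕ}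
    (hj : j ≤ p) : bvalExt (windowInsert π p b) j = bvalExt π j := by
  have hp := p.isLt
  rcases Nat.eq_zero_or_pos j with rfl | hpos
  · simp [bvalExt]
  · rw [bvalExt, bvalExt, dif_pos ⟨hpos, by omega⟩, dif_pos ⟨hpos, by omega⟩,
      ← bval_windowInsert_succAbove π p b]
    congr 1
    rw [Fin.succAbove_of_castSucc_lt _ _ (by rw [Fin.lt_def]; simp; omega)]
    rfl

theorem bvalExt_windowInsert_self {n : ℕ} (π : BG n) (p : Fin (n + 1)) (b : Bool) :
    bvalExt (windowInsert π p b) (p + 1) = if b then -((n : ℤ) + 1) else n + 1 := by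
  rw [bvalExt, dif_pos ⟨by omega, by omega⟩, ← bval_windowInsert_self π p b]
  rfl

theorem bvalExt_windowInsert_of_gt {n : ℕ} (π : BG n) (p : Fin (n + 1)) (b : Bool) {j : ℕ}
    (hj : p < j) (hjn : j ≤ n) : bvalExt (windowInsert π p b) (j + 1) = bvalExt π j := by
  rw [bvalExt, bvalExt, dif_pos ⟨by omega, by omega⟩, dif_pos ⟨by omega, by omega⟩,
    ← bval_windowInsert_succAbove π p b]
  congr 1
  rw [Fin.succAbove_of_le_castSucc _ _ (by rw [Fin.le_def]; simp; omega)]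
  ext
  simp
  omega

theorem desB_eq_sum {n : ℕ} (π : BG n) :
    desB π = ∑ i ∈ Finset.range n, if bvalExt π (i + 1) < bvalExt π i then 1 else 0 := by
  rw [desB, Finset.card_filter]

theorem sum_range_insert {g g' : ℕ → ℕ} {a n : ℕ} (ha : a < n) (h1 : ∀ i < a, g' i = g i)
    (h2 : ∀ i, a < i → i < n → g' (i + 1) = g i) :
    ∑ i ∈ Finset.range (n + 1), g' i + g a = ∑ i ∈ Finset.range n, g i + (g' a + g' (a + 1)) := by
  obtain ⟨m, rfl⟩ := Nat.exists_eq_add_of_lt ha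
  rw [show a + m + 1 + 1 = a + 1 + 1 + m by ring, show a + m + 1 = a + 1 + m by ring,
    Finset.sum_range_add g' (a + 1 + 1) m, Finset.sum_range_add g (a + 1) m,
    Finset.sum_range_succ g', Finset.sum_range_succ g', Finset.sum_range_succ g,
    Finset.sum_congr rfl fun i hi => h1 i (Finset.mem_range.1 hi)]
  have h3 : ∑ i ∈ Finset.range m, g' (a + 1 + 1 + i) = ∑ i ∈ Finset.range m, g (a + 1 + i) := by
    refine Finset.sum_congr rfl fun i hi => ?_
    rw [← h2 (a + 1 + i) (by omega) (by have := Finset.mem_range.1 hi; omega)]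
    congr 1
    ring
  rw [h3]
  ring

/-- The insertion scheme governing type `B` descents. -/
def desScheme : InsertionScheme fun n (π : BG n) => desB π where
  ins _ := windowInsert
  keeps _ π p := decide (bvalExt π (p + 1) < bvalExt π p)
  st_zero π := by simp [desB]
  injective := windowInsert_injective
  sum_keeps n π := by
    rw [desB_eq_sum, Finset.sum_range]
    simp
  st_castSucc n π p b := by
    have h := sum_range_insert (n := n) (a := p)
      (g := fun i => if bvalExt π (i + 1) < bvalExt π i then 1 else 0)
      (g' := fun i => if bvalExt (windowInsert π p.castSucc b) (i + 1) <
        bvalExt (windowInsert π p.castSucc b) i then 1 else 0) p.isLt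
      (fun i hi => by
        rw [bvalExt_windowInsert_of_le _ _ _ (by simp; omega),
          bvalExt_windowInsert_of_le _ _ _ (by simp; omega)])
      (fun i hi hin => by
        rw [bvalExt_windowInsert_of_gt _ _ _ (by simp; omega) (by omega),
          bvalExt_windowInsert_of_gt _ _ _ (by simp; omega) (by omega)])
    have hv := bvalExt_windowInsert_self π p.castSucc b
    rw [Fin.val_castSucc] at hv
    have hl := bvalExt_windowInsert_of_le π p.castSucc b (j := p) (by simp)
    have hr := bvalExt_windowInsert_of_gt π p.castSucc b (j := p + 1) (by simp) (by omega)
    have b1 := abs_le.1 (abs_bvalExt_le π p)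
    have b2 := abs_le.1 (abs_bvalExt_le π (p + 1))
    have hsum : ((if bvalExt (windowInsert π p.castSucc b) (p + 1) <
          bvalExt (windowInsert π p.castSucc b) p then 1 else 0) +
        (if bvalExt (windowInsert π p.castSucc b) (p + 1 + 1) <
          bvalExt (windowInsert π p.castSucc b) (p + 1) then 1 else 0) : ℕ) = 1 := by
      rw [hv, hl, hr]
      cases b <;> simp <;> split_ifs <;> omega
    simp only [hsum] at h
    rw [desB_eq_sum, desB_eq_sum]
    simp only [decide_eq_true_eq]
    split_ifs at h ⊢ <;> omega
  st_last n π b := by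
    have hv := bvalExt_windowInsert_self π (Fin.last n) b
    rw [Fin.val_last] at hv
    have b1 := abs_le.1 (abs_bvalExt_le π n)
    rw [desB_eq_sum, desB_eq_sum, Finset.sum_range_succ, hv,
      bvalExt_windowInsert_of_le _ _ _ (by simp)]
    have h : ∀ i ∈ Finset.range n, (if bvalExt (windowInsert π (Fin.last n) b) (i + 1) <
        bvalExt (windowInsert π (Fin.last n) b) i then 1 else 0 : ℕ) =
        if bvalExt π (i + 1) < bvalExt π i then 1 else 0 := fun i hi => by
      have := Finset.mem_range.1 hi
      rw [bvalExt_windowInsert_of_le _ _ _ (by simp; omega),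
        bvalExt_windowInsert_of_le _ _ _ (by simp; omega)]
    rw [Finset.sum_congr rfl h]
    cases b <;> simp <;> omega
  signWeight_true n π p := by
    simp [windowInsert, signWeight_insertNth, bitSign]
  signWeight_last n π := by
    rw [windowInsert, signWeight_insertNth, sign_extPerm_last]
    simp [signWeight, bitSign]

/-! ### Excedances

Excedances are studied on pairs `(σ, τ)`, where the bit `τ v` records whether the letter of absolute
value `v + 1` is negative. -/

/-- The signed letter of absolute value `v + 1`. -/
def letter {n : ℕ} (π : BG n) (v : Fin n) : ℤ :=
  (if π.2 v then -1 else 1) * ((v : ℤ) + 1)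

/-- The slot `p` carries an excedance: the signed letter increases along the arrow of the
cycle that ends at `p`, or `p` is a negative fixed point. -/
def IsExcSlot {n : ℕ} (π : BG n) (p : Fin n) : Prop :=
  letter π (π.1.symm p) < letter π p ∨ (π.1.symm p = p ∧ π.2 p = true)

instance {n : ℕ} (π : BG n) : DecidablePred (IsExcSlot π) := fun _ =>
  inferInstanceAs (Decidable (_ ∨ _))

/-- The number of excedances of a signed permutation whose signs are indexed by letters. -/
def excLetter {n : ℕ} (π : BG n) : ℕ := ∑ p, if IsExcSlot π p then 1 else 0

/-- Insertion of `±(n+1)` into the cycles of a signed permutation, in front of the letter `q`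
or as a new fixed point. -/
def cycleInsert {n : ℕ} (π : BG n) (q : Fin (n + 1)) (b : Bool) : BG (n + 1) :=
  (Equiv.swap (Fin.last n) q * extPerm (Fin.last n) π.1,
    (Fin.last n).insertNth (α := fun _ => Bool) b π.2)

theorem cycleInsert_injective (n : ℕ) : Function.Injective
    fun x : BG n × Fin (n + 1) × Bool => cycleInsert x.1 x.2.1 x.2.2 := by
  rintro ⟨⟨σ, s⟩, p, b⟩ ⟨⟨τ, t⟩, q, c⟩ h
  simp only [cycleInsert, Prod.mk.injEq] at h
  obtain ⟨h1, h2⟩ := h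
  obtain ⟨rfl, rfl⟩ := Fin.insertNth_inj.1 h2
  have hpq : p = q := by
    have := congrArg (fun e : Equiv.Perm (Fin (n + 1)) => e (Fin.last n)) h1
    simpa [extPerm_self] using this
  subst hpq
  obtain ⟨-, rfl⟩ := extPerm_injective (mul_left_cancel h1)
  rfl

theorem letter_cycleInsert_last {n : ℕ} (π : BG n) (q : Fin (n + 1)) (b : Bool) :
    letter (cycleInsert π q b) (Fin.last n) = if b then -((n : ℤ) + 1) else n + 1 := by
  cases b <;> simp [letter, cycleInsert]

theorem bit_cycleInsert_castSucc {n : ℕ} (π : BG n) (q : Fin (n + 1)) (b : Bool) (v : Fin n) :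
    (cycleInsert π q b).2 v.castSucc = π.2 v := by
  simp [cycleInsert]

theorem letter_cycleInsert_castSucc {n : ℕ} (π : BG n) (q : Fin (n + 1)) (b : Bool) (v : Fin n) :
    letter (cycleInsert π q b) v.castSucc = letter π v := by
  rw [letter, bit_cycleInsert_castSucc, letter, Fin.val_castSucc]

theorem abs_letter_le {n : ℕ} (π : BG n) (v : Fin n) : |letter π v| ≤ n := by
  rw [abs_le, letter]
  have := v.isLt
  split_ifs <;> omega

theorem cycleInsert_symm {n : ℕ} (π : BG n) (q : Fin (n + 1)) (b : Bool) (v : Fin (n + 1)) :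
    (cycleInsert π q b).1.symm v =
      (extPerm (Fin.last n) π.1).symm (Equiv.swap (Fin.last n) q v) := by
  rw [Equiv.symm_apply_eq]
  simp [cycleInsert]

theorem extPerm_last_symm_castSucc {n : ℕ} (σ : Equiv.Perm (Fin n)) (v : Fin n) :
    (extPerm (Fin.last n) σ).symm v.castSucc = (σ.symm v).castSucc := by
  rw [Equiv.symm_apply_eq, extPerm_last_castSucc, Equiv.apply_symm_apply]

theorem extPerm_last_symm_last {n : ℕ} (σ : Equiv.Perm (Fin n)) :
    (extPerm (Fin.last n) σ).symm (Fin.last n) = Fin.last n := by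
  rw [Equiv.symm_apply_eq, extPerm_self]

theorem isExcSlot_cycleInsert_castSucc {n : ℕ} (π : BG n) (q : Fin (n + 1)) (b : Bool)
    (v : Fin n) (h : v.castSucc ≠ q) :
    IsExcSlot (cycleInsert π q b) v.castSucc ↔ IsExcSlot π v := by
  rw [IsExcSlot, cycleInsert_symm, Equiv.swap_apply_of_ne_of_ne (Fin.castSucc_ne_last v) h,
    extPerm_last_symm_castSucc, letter_cycleInsert_castSucc, letter_cycleInsert_castSucc,
    bit_cycleInsert_castSucc, Fin.castSucc_inj, IsExcSlot]

theorem isExcSlot_cycleInsert_self {n : ℕ} (π : BG n) (p : Fin n) (b : Bool) :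
    IsExcSlot (cycleInsert π p.castSucc b) p.castSucc ↔ b = true := by
  have h := abs_le.1 (abs_letter_le π p)
  rw [IsExcSlot, cycleInsert_symm, Equiv.swap_apply_right, extPerm_last_symm_last,
    letter_cycleInsert_last, letter_cycleInsert_castSucc]
  have hne : Fin.last n ≠ p.castSucc := (Fin.castSucc_ne_last p).symm
  cases b <;> simp [hne] <;> omega

theorem isExcSlot_cycleInsert_last {n : ℕ} (π : BG n) (p : Fin n) (b : Bool) :
    IsExcSlot (cycleInsert π p.castSucc b) (Fin.last n) ↔ b = false := by
  have h := abs_le.1 (abs_letter_le π (π.1.symm p))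
  rw [IsExcSlot, cycleInsert_symm, Equiv.swap_apply_left, extPerm_last_symm_castSucc,
    letter_cycleInsert_last, letter_cycleInsert_castSucc]
  have hne := Fin.castSucc_ne_last (π.1.symm p)
  cases b <;> simp [hne] <;> omega

theorem isExcSlot_cycleInsert_last_last {n : ℕ} (π : BG n) (b : Bool) :
    IsExcSlot (cycleInsert π (Fin.last n) b) (Fin.last n) ↔ b = true := by
  rw [IsExcSlot, cycleInsert_symm, Equiv.swap_self, Equiv.refl_apply, extPerm_last_symm_last]
  simp [cycleInsert]

/-- The insertion scheme governing type `B` excedances. -/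
def excScheme : InsertionScheme fun n (π : BG n) => excLetter π where
  ins _ := cycleInsert
  keeps _ π p := decide (IsExcSlot π p)
  st_zero π := by simp [excLetter]
  injective := cycleInsert_injective
  sum_keeps n π := by simp [excLetter]
  st_castSucc n π p b := by
    rw [excLetter, Fin.sum_univ_castSucc, excLetter, ← Finset.add_sum_erase _ _ (Finset.mem_univ p),
      ← Finset.add_sum_erase _ _ (Finset.mem_univ p)]
    have h : ∀ v ∈ Finset.univ.erase p, (if IsExcSlot (cycleInsert π p.castSucc b) v.castSucc
        then 1 else 0 : ℕ) = if IsExcSlot π v then 1 else 0 := fun v hv => by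
      have hne : v.castSucc ≠ p.castSucc := by simpa using (Finset.mem_erase.1 hv).1
      simp only [isExcSlot_cycleInsert_castSucc π _ b v hne]
    rw [Finset.sum_congr rfl h]
    simp only [isExcSlot_cycleInsert_self, isExcSlot_cycleInsert_last, decide_eq_true_eq]
    cases b <;> split_ifs <;> simp_all <;> omega
  st_last n π b := by
    rw [excLetter, Fin.sum_univ_castSucc, excLetter]
    simp only [isExcSlot_cycleInsert_castSucc π (Fin.last n) b _ (Fin.castSucc_ne_last _),
      isExcSlot_cycleInsert_last_last]
    cases b <;> simp
  signWeight_true n π p := by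
    rw [cycleInsert, cycleInsert, signWeight_insertNth, signWeight_insertNth]
    simp [bitSign]
  signWeight_last n π := by
    rw [cycleInsert, signWeight_insertNth, Equiv.swap_self, ← Equiv.Perm.one_def, one_mul,
      sign_extPerm_last]
    simp [signWeight, bitSign]

/-- Reindex the signs of a signed permutation from positions to letters. -/
def signsByLetter (n : ℕ) : BG n ≃ BG n where
  toFun π := (π.1, π.2 ∘ π.1.symm)
  invFun π := (π.1, π.2 ∘ π.1)
  left_inv π := by
    simp [Function.comp_assoc]
  right_inv π := by
    simp [Function.comp_assoc]

theorem signWeight_signsByLetter {n : ℕ} (π : BG n) :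
    signWeight (signsByLetter n π) = signWeight π := by
  rw [signWeight, signWeight]
  congr 1
  exact Equiv.prod_comp π.1.symm fun i => bitSign (π.2 i)

theorem letter_signsByLetter {n : ℕ} (π : BG n) (i : Fin n) :
    letter (signsByLetter n π) (π.1 i) = bval π i := by
  simp [letter, signsByLetter, bval]

theorem bvalExt_natAbs {n : ℕ} (π : BG n) (i : Fin n) :
    bvalExt π (bval π i).natAbs = letter (signsByLetter n π) (π.1 (π.1 i)) := by
  have h : (bval π i).natAbs = (π.1 i : ℕ) + 1 := by
    rw [bval]
    split_ifs <;> omega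
  rw [h, bvalExt, dif_pos ⟨by omega, by omega⟩, letter_signsByLetter]
  rfl

theorem excB_eq {n : ℕ} (π : BG n) : excB π = excLetter (signsByLetter n π) := by
  have h1 : ∀ i, bval π i < bvalExt π (bval π i).natAbs ↔
      letter (signsByLetter n π) (π.1 i) < letter (signsByLetter n π) (π.1 (π.1 i)) := fun i => by
    rw [bvalExt_natAbs, ← letter_signsByLetter π i]
  have h2 : ∀ i : Fin n, bval π i = -((i : ℤ) + 1) ↔ π.1 i = i ∧ π.2 i = true := fun i => by
    rw [bval, Fin.ext_iff]
    cases π.2 i <;> simp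
    omega
  have key : ∀ p, (if IsExcSlot (signsByLetter n π) p then 1 else 0 : ℕ) =
      (if letter (signsByLetter n π) (π.1.symm p) < letter (signsByLetter n π) p then 1 else 0) +
        if π.1 p = p ∧ π.2 p = true then 1 else 0 := fun p => by
    have h3 : (signsByLetter n π).1.symm p = p ∧ (signsByLetter n π).2 p = true ↔
        π.1 p = p ∧ π.2 p = true := by
      simp only [signsByLetter, Equiv.coe_fn_mk, Function.comp]
      constructor
      · rintro ⟨h, h'⟩
        rw [h] at h'
        exact ⟨((Equiv.symm_apply_eq _).1 h).symm, h'⟩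
      · rintro ⟨h, h'⟩
        have := (Equiv.symm_apply_eq π.1).2 h.symm
        rw [this]
        exact ⟨rfl, h'⟩
    have h4 : IsExcSlot (signsByLetter n π) p ↔
        letter (signsByLetter n π) (π.1.symm p) < letter (signsByLetter n π) p ∨
          (π.1 p = p ∧ π.2 p = true) := or_congr Iff.rfl h3
    rw [if_congr h4 rfl rfl]
    by_cases h : π.1 p = p ∧ π.2 p = true
    · have := (Equiv.symm_apply_eq π.1).2 h.1.symm
      simp [h, this]
    · simp only [h, or_false, if_false, add_zero]
  rw [excB, excLetter, Finset.sum_congr rfl fun p _ => key p, Finset.sum_add_distrib,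
    Finset.card_filter, Finset.card_filter]
  simp only [h1, h2]
  congr 1
  rw [← Equiv.sum_comp (π.1.trans π.1) fun p =>
    if letter (signsByLetter n π) (π.1.symm p) < letter (signsByLetter n π) p then 1 else 0]
  simp

/-! ### Coefficient arrays and their test functionals -/

/-- The array `c` collects half of the type `B` Eulerian numbers: its rows are the coefficients of
`(B_n(t) + ε (1 - t) ^ n) / 2`. -/
structure IsEulerianHalf (c : ℕ → ℕ → ℕ) (ε : ℝ) : Prop where
  abs_eq : |ε| = 1
  finite_support : ∀ n, (Function.support fun k => (c n k : ℝ)).Finite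
  tsum_mul : ∀ n (f : ℕ → ℝ), ∑' k, f k * (c n k : ℝ) = (eulerSum n f + ε * altSum n f) / 2

theorem tsum_mul_card {α : Type*} [Fintype α] (P : α → Prop) [DecidablePred P] (st : α → ℕ)
    (f : ℕ → ℝ) :
    ∑' k, f k * ((Finset.univ.filter fun a => P a ∧ st a = k).card : ℝ) =
      ∑ a, if P a then f (st a) else 0 := by
  have h (k : ℕ) : f k * ((Finset.univ.filter fun a => P a ∧ st a = k).card : ℝ) =
      ∑ a, if P a ∧ st a = k then f k else 0 := by
    rw [← Finset.sum_filter, Finset.sum_const, nsmul_eq_mul, mul_comm]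
  have hs (a : α) (k : ℕ) (hk : k ≠ st a) : (if P a ∧ st a = k then f k else 0) = 0 :=
    if_neg fun h => hk h.2.symm
  simp_rw [h]
  rw [Summable.tsum_finsetSum fun a _ => summable_of_ne_finset_zero (s := {st a})
    fun k hk => hs a k (by simpa using hk)]
  refine Finset.sum_congr rfl fun a _ => ?_
  rw [tsum_eq_single (st a) (hs a)]
  simp

theorem finite_support_card {α : Type*} [Fintype α] (P : α → Prop) [DecidablePred P]
    (st : α → ℕ) : (Function.support fun k =>
      ((Finset.univ.filter fun a => P a ∧ st a = k).card : ℝ)).Finite := by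
  refine (Set.finite_range st).subset fun k hk => ?_
  have : (Finset.univ.filter fun a => P a ∧ st a = k).card ≠ 0 := by
    simpa using hk
  obtain ⟨a, ha⟩ := Finset.card_ne_zero.1 this
  exact ⟨a, (Finset.mem_filter.1 ha).2.2⟩

theorem isEulerianHalf_even (st : ∀ n, BG n → ℕ)
    (h1 : ∀ n f, ∑ π : BG n, f (st n π) = eulerSum n f)
    (h2 : ∀ n f, ∑ π : BG n, signWeight π * f (st n π) = altSum n f) :
    IsEulerianHalf
      (fun n k => (Finset.univ.filter fun π : BG n => Even (invBB π) ∧ st n π = k).card) 1 where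
  abs_eq := abs_one
  finite_support n := finite_support_card _ _
  tsum_mul n f := by
    rw [tsum_mul_card, ← h1, ← h2, one_mul, ← Finset.sum_add_distrib, Finset.sum_div]
    refine Finset.sum_congr rfl fun π _ => ?_
    rw [← neg_one_pow_invBB]
    split_ifs with h
    · rw [h.neg_one_pow]
      ring
    · rw [(Nat.not_even_iff_odd.1 h).neg_one_pow]
      ring

theorem isEulerianHalf_odd (st : ∀ n, BG n → ℕ)
    (h1 : ∀ n f, ∑ π : BG n, f (st n π) = eulerSum n f)
    (h2 : ∀ n f, ∑ π : BG n, signWeight π * f (st n π) = altSum n f) :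
    IsEulerianHalf
      (fun n k => (Finset.univ.filter fun π : BG n => ¬ Even (invBB π) ∧ st n π = k).card)
      (-1) where
  abs_eq := by simp
  finite_support n := finite_support_card _ _
  tsum_mul n f := by
    rw [tsum_mul_card, ← h1, ← h2, neg_one_mul, ← sub_eq_add_neg, ← Finset.sum_sub_distrib,
      Finset.sum_div]
    refine Finset.sum_congr rfl fun π _ => ?_
    rw [← neg_one_pow_invBB]
    by_cases h : Even (invBB π)
    · rw [if_neg (not_not.2 h), h.neg_one_pow]
      ring
    · rw [if_pos h, (Nat.not_even_iff_odd.1 h).neg_one_pow]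
      ring

theorem sum_excB (n : ℕ) (f : ℕ → ℝ) : ∑ π : BG n, f (excB π) = eulerSum n f := by
  simp_rw [excB_eq]
  rw [Equiv.sum_comp (signsByLetter n) fun π => f (excLetter π)]
  exact excScheme.sum_st n f

theorem sum_signWeight_mul_excB (n : ℕ) (f : ℕ → ℝ) :
    ∑ π : BG n, signWeight π * f (excB π) = altSum n f := by
  rw [← excScheme.sum_signWeight_mul n f]
  refine Eq.trans ?_ (Equiv.sum_comp (signsByLetter n) _)
  refine Finset.sum_congr rfl fun π _ => ?_
  rw [excB_eq, signWeight_signsByLetter]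

theorem isEulerianHalf_cBExcP : IsEulerianHalf cBExcP 1 :=
  isEulerianHalf_even (fun _ => excB) sum_excB sum_signWeight_mul_excB

theorem isEulerianHalf_cBExcM : IsEulerianHalf cBExcM (-1) :=
  isEulerianHalf_odd (fun _ => excB) sum_excB sum_signWeight_mul_excB

theorem isEulerianHalf_cBDesP : IsEulerianHalf cBDesP 1 :=
  isEulerianHalf_even (fun _ => desB) desScheme.sum_st desScheme.sum_signWeight_mul

theorem isEulerianHalf_cBDesM : IsEulerianHalf cBDesM (-1) :=
  isEulerianHalf_odd (fun _ => desB) desScheme.sum_st desScheme.sum_signWeight_mul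

/-! ### Moments -/

theorem eulerSum_linear (n : ℕ) (a b : ℝ) :
    eulerSum n (fun k => a * k + b) = 2 ^ n * n.factorial * (a * n / 2 + b) := by
  induction n generalizing a b with
  | zero => simp [eulerSum]
  | succ n ih =>
    have h : eulerSum (n + 1) (fun k => a * k + b) =
        eulerSum n fun k => (2 * n * a) * k + (a * (2 * n + 1) + b * (2 * n + 2)) := by
      rw [eulerSum]
      congr 1
      funext k
      push_cast
      ring
    rw [h, ih, Nat.factorial_succ]
    push_cast
    ring

theorem eulerSum_quadratic {n : ℕ} (hn : 2 ≤ n) (a b d : ℝ) :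
    eulerSum n (fun k => a * k ^ 2 + b * k + d) =
      2 ^ n * n.factorial * (a * ((n + 1) / 12 + n ^ 2 / 4) + b * n / 2 + d) := by
  induction n, hn using Nat.le_induction generalizing a b d with
  | base =>
    simp [eulerSum]
    ring
  | succ n hn ih =>
    have h : eulerSum (n + 1) (fun k => a * k ^ 2 + b * k + d) =
        eulerSum n fun k => ((2 * n - 2) * a) * k ^ 2 + (4 * n * a + 2 * n * b) * k +
          ((2 * n + 1) * a + (2 * n + 1) * b + (2 * n + 2) * d) := by
      rw [eulerSum]
      congr 1
      funext k
      push_cast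
      ring
    rw [h, ih, Nat.factorial_succ]
    push_cast
    ring

theorem altSum_zero (n : ℕ) : altSum n (fun _ => 0) = 0 := by
  induction n with
  | zero => rfl
  | succ n ih =>
    rw [altSum]
    simpa using ih

theorem altSum_const {n : ℕ} (hn : 1 ≤ n) (a : ℝ) : altSum n (fun _ => a) = 0 := by
  obtain ⟨m, rfl⟩ := Nat.exists_eq_add_of_le' hn
  rw [altSum]
  simpa using altSum_zero m

theorem altSum_id {n : ℕ} (hn : 2 ≤ n) : altSum n (fun k => (k : ℝ)) = 0 := by
  obtain ⟨m, rfl⟩ := Nat.exists_eq_add_of_le' hn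
  rw [altSum]
  simpa using altSum_const (n := m + 1) (by omega) (-1)

theorem altSum_sq {n : ℕ} (hn : 3 ≤ n) : altSum n (fun k => (k : ℝ) ^ 2) = 0 := by
  obtain ⟨m, rfl⟩ := Nat.exists_eq_add_of_le' hn
  rw [altSum, altSum, ← altSum_const (n := m + 1) (by omega) 2]
  congr 1
  funext k
  push_cast
  ring

theorem abs_altSum_le {f : ℕ → ℝ} {M : ℝ} (n : ℕ) (hf : ∀ k, |f k| ≤ M) :
    |altSum n f| ≤ 2 ^ n * M := by
  induction n generalizing f M with
  | zero => simpa [altSum] using hf 0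
  | succ n ih =>
    have := ih (f := fun k => f k - f (k + 1)) (M := 2 * M) fun k =>
      (abs_sub _ _).trans (by linarith [hf k, hf (k + 1)])
    rwa [altSum, pow_succ, mul_assoc]

namespace IsEulerianHalf

variable {c : ℕ → ℕ → ℕ} {ε : ℝ}

theorem rowSum_eq (h : IsEulerianHalf c ε) {n : ℕ} (hn : 1 ≤ n) :
    rowSum c n = 2 ^ n * n.factorial / 2 := by
  have h1 := h.tsum_mul n fun _ => 1
  have h2 := eulerSum_linear n 0 1
  simp only [zero_mul, zero_div, zero_add, mul_one] at h2
  rw [altSum_const hn, h2] at h1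
  simpa [rowSum] using h1

theorem rowMean_eq (h : IsEulerianHalf c ε) {n : ℕ} (hn : 2 ≤ n) : rowMean c n = n / 2 := by
  have h1 := h.tsum_mul n fun k => k
  have h2 := eulerSum_linear n 1 0
  simp only [one_mul, add_zero] at h2
  rw [altSum_id hn, h2] at h1
  have h3 : (2 ^ n * n.factorial : ℝ) ≠ 0 := by positivity
  rw [rowMean, h1, h.rowSum_eq (by omega)]
  field_simp
  ring

theorem rowVar_eq (h : IsEulerianHalf c ε) {n : ℕ} (hn : 3 ≤ n) :
    rowVar c n = ((n : ℝ) + 1) / 12 := by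
  have h1 := h.tsum_mul n fun k => (k : ℝ) ^ 2
  have h2 := eulerSum_quadratic (n := n) (by omega) 1 0 0
  simp only [one_mul, zero_mul, zero_div, add_zero] at h2
  rw [altSum_sq hn, h2] at h1
  have h3 : (2 ^ n * n.factorial : ℝ) ≠ 0 := by positivity
  rw [rowVar, h1, h.rowSum_eq (by omega), h.rowMean_eq (by omega)]
  field_simp
  ring

end IsEulerianHalf

/-! ### The Irwin–Hall distribution -/

/-- The distribution function of the sum of `n` independent uniform variables on `[0, 1]`. -/
noncomputable def irwinHall : ℕ → ℝ → ℝ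
  | 0, x => if 0 ≤ x then 1 else 0
  | n + 1, x => (x * irwinHall n x + (n + 1 - x) * irwinHall n (x - 1)) / (n + 1)

theorem eulerSum_combination (n : ℕ) (a b : ℝ) (f g : ℕ → ℝ) :
    eulerSum n (fun k => a * f k + b * g k) = a * eulerSum n f + b * eulerSum n g := by
  induction n generalizing f g with
  | zero => rfl
  | succ n ih =>
    rw [eulerSum, eulerSum, eulerSum, ← ih]
    congr 1
    funext k
    ring

theorem eulerSum_indicator (n : ℕ) (m : ℤ) :
    eulerSum n (fun k => if (k : ℤ) ≤ m then 1 else 0) =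
      2 ^ n * n.factorial * irwinHall n (m + 1 / 2) := by
  induction n generalizing m with
  | zero =>
    have h : (0 : ℝ) ≤ m + 1 / 2 ↔ (0 : ℤ) ≤ m := by
      constructor
      · intro h
        by_contra! hm
        have : (m : ℝ) ≤ -1 := by exact_mod_cast Int.le_sub_one_of_lt hm
        linarith
      · intro h
        have : (0 : ℝ) ≤ m := by exact_mod_cast h
        linarith
    simp only [eulerSum, irwinHall, h]
    simp
  | succ n ih =>
    have h : eulerSum (n + 1) (fun k => if (k : ℤ) ≤ m then 1 else 0) =
        eulerSum n fun k => (2 * (m : ℝ) + 1) * (if (k : ℤ) ≤ m then 1 else 0) +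
          (2 * n + 1 - 2 * m) * (if (k : ℤ) ≤ m - 1 then 1 else 0) := by
      rw [eulerSum]
      congr 1
      funext k
      rcases lt_trichotomy (k : ℤ) m with hk | hk | hk
      · rw [if_pos hk.le, if_pos (by push_cast; omega), if_pos (by omega)]
        ring
      · rw [if_pos hk.le, if_neg (by push_cast; omega), if_neg (by omega), ← hk]
        push_cast
        ring
      · rw [if_neg (by omega), if_neg (by push_cast; omega), if_neg (by omega)]
        ring
    have h2 : ((m - 1 : ℤ) : ℝ) + 1 / 2 = m + 1 / 2 - 1 := by
      push_cast
      ring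
    rw [h, eulerSum_combination, ih, ih, h2, irwinHall, Nat.factorial_succ]
    push_cast
    field_simp
    ring

theorem irwinHall_of_neg (n : ℕ) {x : ℝ} (hx : x < 0) : irwinHall n x = 0 := by
  induction n generalizing x with
  | zero => exact if_neg hx.not_ge
  | succ n ih => rw [irwinHall, ih hx, ih (by linarith)]; simp

theorem continuous_irwinHall_succ (n : ℕ) : Continuous (irwinHall (n + 1)) := by
  induction n with
  | zero =>
    have h : irwinHall (0 + 1) = fun x => max x 0 - max (x - 1) 0 := by
      funext x
      simp only [irwinHall]
      rcases lt_or_ge x 0 with h0 | h0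
      · rw [if_neg (by linarith), if_neg (by linarith), max_eq_right h0.le,
          max_eq_right (by linarith)]
        simp
      · rcases lt_or_ge x 1 with h1 | h1
        · rw [if_pos h0, if_neg (by linarith), max_eq_left h0, max_eq_right (by linarith)]
          simp
        · rw [if_pos h0, if_pos (by linarith), max_eq_left h0, max_eq_left (by linarith)]
          simp
    rw [h]
    fun_prop
  | succ n ih =>
    have h : irwinHall (n + 1 + 1) = fun x => (x * irwinHall (n + 1) x +
        (((n + 1 : ℕ) : ℝ) + 1 - x) * irwinHall (n + 1) (x - 1)) / (((n + 1 : ℕ) : ℝ) + 1) := rfl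
    rw [h]
    fun_prop

theorem hasDerivAt_irwinHall_zero {x : ℝ} (hx : x ≠ 0) : HasDerivAt (irwinHall 0) 0 x := by
  rcases hx.lt_or_gt with h | h
  · refine (hasDerivAt_const x (0 : ℝ)).congr_of_eventuallyEq ?_
    filter_upwards [Iio_mem_nhds h] with y hy using if_neg (not_le.2 hy)
  · refine (hasDerivAt_const x (1 : ℝ)).congr_of_eventuallyEq ?_
    filter_upwards [Ioi_mem_nhds h] with y hy using if_pos (le_of_lt hy)

theorem hasDerivAt_irwinHall_succ_of_hasDerivAt {n : ℕ} {x d e : ℝ}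
    (h1 : HasDerivAt (irwinHall n) d x) (h2 : HasDerivAt (irwinHall n) e (x - 1)) :
    HasDerivAt (irwinHall (n + 1))
      ((irwinHall n x + x * d - irwinHall n (x - 1) + (n + 1 - x) * e) / (n + 1)) x := by
  have h3 : HasDerivAt (fun y => irwinHall n (y - 1)) e x := by
    simpa using h2.comp_sub_const x 1
  have h4 := (((hasDerivAt_id x).mul h1).add
    (((hasDerivAt_id x).const_sub ((n : ℝ) + 1)).mul h3)).div_const ((n : ℝ) + 1)
  refine h4.congr_deriv ?_
  simp only [id]
  ring

theorem hasDerivAt_irwinHall_succ (n : ℕ) {x : ℝ} (hx : x ∉ Set.range ((↑) : ℤ → ℝ)) :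
    HasDerivAt (irwinHall (n + 1)) (irwinHall n x - irwinHall n (x - 1)) x := by
  have hx' {y : ℝ} (hy : y ∉ Set.range ((↑) : ℤ → ℝ)) : y - 1 ∉ Set.range ((↑) : ℤ → ℝ) := by
    rintro ⟨m, hm⟩
    exact hy ⟨m + 1, by push_cast; linarith⟩
  induction n generalizing x with
  | zero =>
    have h0 {y : ℝ} (hy : y ∉ Set.range ((↑) : ℤ → ℝ)) : y ≠ 0 := fun h => hy ⟨0, by simp [h]⟩
    refine (hasDerivAt_irwinHall_succ_of_hasDerivAt (hasDerivAt_irwinHall_zero (h0 hx))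
      (hasDerivAt_irwinHall_zero (h0 (hx' hx)))).congr_deriv ?_
    simp
  | succ n ih =>
    refine (hasDerivAt_irwinHall_succ_of_hasDerivAt (ih hx) (ih (hx' hx))).congr_deriv ?_
    rw [irwinHall, irwinHall]
    push_cast
    field_simp
    ring

theorem intervalIntegrable_irwinHall (n : ℕ) (a b : ℝ) :
    IntervalIntegrable (irwinHall n) MeasureTheory.volume a b := by
  cases n with
  | zero =>
    refine Monotone.intervalIntegrable fun x y hxy => ?_
    simp only [irwinHall]
    split_ifs <;> linarith
  | succ n => exact (continuous_irwinHall_succ n).intervalIntegrable a b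

theorem irwinHall_succ_eq_integral (n : ℕ) (x : ℝ) :
    irwinHall (n + 1) x = ∫ y in (x - 1)..x, irwinHall n y := by
  have hI : IntervalIntegrable (fun y => irwinHall n (y - 1)) MeasureTheory.volume (-1) x := by
    simpa using (intervalIntegrable_irwinHall n (-1 - 1) (x - 1)).comp_sub_right 1
  have h := MeasureTheory.integral_eq_of_hasDerivAt_off_countable (irwinHall (n + 1))
    (fun y => irwinHall n y - irwinHall n (y - 1)) (a := -1) (b := x)
    (Set.countable_range ((↑) : ℤ → ℝ)) (continuous_irwinHall_succ n).continuousOn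
    (fun y hy => hasDerivAt_irwinHall_succ n hy.2)
    ((intervalIntegrable_irwinHall n _ _).sub hI)
  rw [irwinHall_of_neg _ (by norm_num : (-1 : ℝ) < 0), sub_zero,
    intervalIntegral.integral_sub (intervalIntegrable_irwinHall n _ _) hI,
    intervalIntegral.integral_comp_sub_right] at h
  have hz : ∫ y in (-1 - 1 : ℝ)..(-1), irwinHall n y = 0 := by
    rw [intervalIntegral.integral_congr (g := fun _ => 0)]
    · simp
    · intro y hy
      rw [Set.uIcc_of_le (by norm_num)] at hy
      exact irwinHall_of_neg n (by linarith [hy.2])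
  have e1 := intervalIntegral.integral_add_adjacent_intervals
    (intervalIntegrable_irwinHall n (-1 - 1) (-1)) (intervalIntegrable_irwinHall n (-1) x)
  have e2 := intervalIntegral.integral_add_adjacent_intervals
    (intervalIntegrable_irwinHall n (-1 - 1) (x - 1)) (intervalIntegrable_irwinHall n (x - 1) x)
  linarith

/-! ### The central limit theorem for sums of uniform variables -/

open MeasureTheory ProbabilityTheory in
/-- The uniform distribution on `[0, 1]`. -/
noncomputable def unitUniform : Measure ℝ := volume.restrict (Set.Icc 0 1)

instance : MeasureTheory.IsProbabilityMeasure unitUniform :=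
  ⟨by simp [unitUniform]⟩

open MeasureTheory ProbabilityTheory in
/-- The joint law of a sequence of independent uniform variables on `[0, 1]`. -/
noncomputable def unitUniformSeq : Measure (ℕ → ℝ) := Measure.infinitePi fun _ => unitUniform

instance : MeasureTheory.IsProbabilityMeasure unitUniformSeq := by
  unfold unitUniformSeq
  infer_instance

open MeasureTheory ProbabilityTheory in
theorem iIndepFun_unitUniformSeq : iIndepFun (fun (i : ℕ) (ω : ℕ → ℝ) => ω i) unitUniformSeq :=
  iIndepFun_infinitePi (P := fun _ => unitUniform) (X := fun _ x => x) fun _ => measurable_id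

open MeasureTheory ProbabilityTheory in
theorem map_eval_unitUniformSeq (i : ℕ) :
    unitUniformSeq.map (fun ω : ℕ → ℝ => ω i) = unitUniform :=
  Measure.infinitePi_map_eval (fun _ => unitUniform) i

open MeasureTheory ProbabilityTheory in
theorem integral_unitUniform (f : ℝ → ℝ) : ∫ x, f x ∂unitUniform = ∫ x in (0 : ℝ)..1, f x := by
  rw [unitUniform, integral_Icc_eq_integral_Ioc, intervalIntegral.integral_of_le zero_le_one]

open MeasureTheory ProbabilityTheory in
theorem map_sum_unitUniformSeq_succ (n : ℕ) :
    unitUniformSeq.map (fun ω : ℕ → ℝ => ∑ i ∈ Finset.range (n + 1), ω i) =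
      unitUniform.conv (unitUniformSeq.map fun ω : ℕ → ℝ => ∑ i ∈ Finset.range n, ω i) := by
  have h := (iIndepFun_unitUniformSeq.indepFun_finsetSum_of_notMem
    (fun i => measurable_pi_apply i) (Finset.notMem_range_self (n := n))).symm
  have h2 := h.map_add_eq_map_conv_map (measurable_pi_apply n) (by fun_prop)
  rw [map_eval_unitUniformSeq] at h2
  convert h2 using 2
  · funext ω
    simp [Finset.sum_range_succ, add_comm]
  · congr 1
    funext ω
    simp

open MeasureTheory ProbabilityTheory in
theorem measureReal_conv_Iic (μ ν : Measure ℝ) [IsProbabilityMeasure μ] [IsProbabilityMeasure ν]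
    (x : ℝ) : (μ.conv ν).real (Set.Iic x) = ∫ u, ν.real (Set.Iic (x - u)) ∂μ := by
  have h : (μ.conv ν) (Set.Iic x) = ∫⁻ u, ν (Set.Iic (x - u)) ∂μ := by
    rw [← lintegral_indicator_one measurableSet_Iic,
      Measure.lintegral_conv (measurable_one.indicator measurableSet_Iic)]
    refine lintegral_congr fun u => ?_
    rw [← lintegral_indicator_one measurableSet_Iic]
    refine lintegral_congr fun v => ?_
    simp [Set.indicator, le_sub_iff_add_le']
  rw [measureReal_def, h, integral_eq_lintegral_of_nonneg_ae]
  · congr 1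
    refine lintegral_congr fun u => ?_
    rw [ofReal_measureReal]
  · exact ae_of_all _ fun _ => measureReal_nonneg
  · have : Antitone fun u => ν.real (Set.Iic (x - u)) := fun a b hab =>
      measureReal_mono (Set.Iic_subset_Iic.2 (by linarith))
    exact this.measurable.aestronglyMeasurable

open MeasureTheory ProbabilityTheory in
theorem measureReal_sum_unitUniformSeq (n : ℕ) (x : ℝ) :
    (unitUniformSeq.map fun ω : ℕ → ℝ => ∑ i ∈ Finset.range n, ω i).real (Set.Iic x) =
      irwinHall n x := by
  induction n generalizing x with
  | zero => simp [irwinHall, measureReal_def, Set.indicator, apply_ite]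
  | succ n ih =>
    have : IsProbabilityMeasure
        (unitUniformSeq.map fun ω : ℕ → ℝ => ∑ i ∈ Finset.range n, ω i) :=
      Measure.isProbabilityMeasure_map (by fun_prop)
    rw [map_sum_unitUniformSeq_succ, measureReal_conv_Iic, integral_unitUniform,
      irwinHall_succ_eq_integral]
    simp only [ih]
    rw [intervalIntegral.integral_comp_sub_left (fun y => irwinHall n y) x, sub_zero]

theorem monotone_irwinHall (n : ℕ) : Monotone (irwinHall n) := by
  intro x y hxy
  have := MeasureTheory.Measure.isProbabilityMeasure_map (μ := unitUniformSeq)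
    (f := fun ω : ℕ → ℝ => ∑ i ∈ Finset.range n, ω i) (by fun_prop)
  rw [← measureReal_sum_unitUniformSeq, ← measureReal_sum_unitUniformSeq]
  exact MeasureTheory.measureReal_mono (Set.Iic_subset_Iic.2 hxy)

open MeasureTheory ProbabilityTheory in
theorem stdNormalCDF_eq (x : ℝ) : stdNormalCDF x = (gaussianReal 0 1).real (Set.Iic x) := by
  rw [measureReal_def, gaussianReal_apply_eq_integral 0 one_ne_zero, ENNReal.toReal_ofReal]
  · refine setIntegral_congr_fun measurableSet_Iic fun t _ => ?_
    simp [gaussianPDFReal]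
    ring
  · exact integral_nonneg fun t => gaussianPDFReal_nonneg 0 1 t

open MeasureTheory ProbabilityTheory in
theorem tendsto_irwinHall (x : ℝ) :
    Filter.Tendsto (fun n : ℕ => irwinHall n (n / 2 + x * √(n / 12))) Filter.atTop
      (nhds (stdNormalCDF x)) := by
  have hmap : ∀ i, IdentDistrib (fun ω : ℕ → ℝ => ω i) (fun ω : ℕ → ℝ => ω 0)
      unitUniformSeq unitUniformSeq := fun i =>
    ⟨(measurable_pi_apply i).aemeasurable, (measurable_pi_apply 0).aemeasurable, by
      rw [map_eval_unitUniformSeq, map_eval_unitUniformSeq]⟩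
  have hI (f : ℝ → ℝ) (hf : Continuous f) :
      ∫ ω, f (ω 0) ∂unitUniformSeq = ∫ x in (0 : ℝ)..1, f x := by
    rw [← integral_unitUniform, ← map_eval_unitUniformSeq 0,
      integral_map (measurable_pi_apply 0).aemeasurable hf.aestronglyMeasurable]
  have hX0 : ∫ ω, √12 * (ω 0 - 1 / 2) ∂unitUniformSeq = 0 := by
    rw [hI (fun u => √12 * (u - 1 / 2)) (by fun_prop)]
    simp
  have hX1 : ∫ ω, (√12 * (ω 0 - 1 / 2)) ^ 2 ∂unitUniformSeq = 1 := by
    rw [hI (fun u => (√12 * (u - 1 / 2)) ^ 2) (by fun_prop)]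
    simp only [mul_pow]
    rw [intervalIntegral.integral_const_mul,
      intervalIntegral.integral_comp_sub_right (fun u => u ^ 2) (1 / 2), integral_pow,
      Real.sq_sqrt (by norm_num)]
    norm_num
  have hclt := tendstoInDistribution_inv_sqrt_mul_sum (P := unitUniformSeq)
    (P' := gaussianReal 0 1) (Y := id) (X := fun i ω => √12 * (ω i - 1 / 2))
    HasLaw.id hX0 hX1
    (iIndepFun_unitUniformSeq.comp (fun _ u => √12 * (u - 1 / 2)) fun _ => by fun_prop)
    (fun i => (hmap i).comp (u := fun u => √12 * (u - 1 / 2)) (by fun_prop))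
  have h := ProbabilityMeasure.tendsto_measure_of_null_frontier_of_tendsto' hclt.tendsto
    (E := Set.Iic x) (by
      have := nullSingletonClass_gaussianReal (μ := 0) (v := 1) one_ne_zero
      simp)
  simp only [ProbabilityMeasure.coe_mk, Measure.map_id] at h
  have h2 := (ENNReal.continuousAt_toReal (measure_ne_top _ _)).tendsto.comp h
  rw [stdNormalCDF_eq, measureReal_def]
  refine h2.congr' ?_
  filter_upwards [Filter.eventually_gt_atTop 0] with n hn
  have hn' : (0 : ℝ) < n := by exact_mod_cast hn
  rw [← measureReal_sum_unitUniformSeq, Function.comp, measureReal_def,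
    Measure.map_apply (by fun_prop) measurableSet_Iic,
    Measure.map_apply (by fun_prop) measurableSet_Iic]
  congr 2
  ext ω
  have h12 : (0 : ℝ) < √12 := by positivity
  have hsn : (0 : ℝ) < √n := by positivity
  simp only [Set.mem_preimage, Set.mem_Iic]
  rw [← Finset.mul_sum, Finset.sum_sub_distrib, Real.sqrt_div' _ (by norm_num), inv_mul_le_iff₀ hsn,
    ← le_div_iff₀' h12]
  simp
  constructor <;> intro h <;> ring_nf at h ⊢ <;> linarith

/-! ### Uniform convergence of distribution functions -/

theorem continuous_stdNormalCDF : Continuous stdNormalCDF := by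
  have h : MeasureTheory.Integrable
      fun t : ℝ => Real.exp (-t ^ 2 / 2) / Real.sqrt (2 * Real.pi) := by
    convert ProbabilityTheory.integrable_gaussianPDFReal 0 1 using 2 with t
    simp [ProbabilityTheory.gaussianPDFReal]
    ring
  have h2 : stdNormalCDF = fun x => (∫ t in (0 : ℝ)..x,
      Real.exp (-t ^ 2 / 2) / Real.sqrt (2 * Real.pi)) + stdNormalCDF 0 := by
    funext x
    rw [stdNormalCDF, stdNormalCDF,
      ← intervalIntegral.integral_Iic_sub_Iic h.integrableOn h.integrableOn, sub_add_cancel]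
  rw [h2]
  exact (intervalIntegral.continuous_primitive (fun a b => h.intervalIntegrable) 0).add
    continuous_const

theorem tendsto_stdNormalCDF_atBot : Filter.Tendsto stdNormalCDF Filter.atBot (nhds 0) := by
  refine (ProbabilityTheory.tendsto_cdf_atBot (ProbabilityTheory.gaussianReal 0 1)).congr fun x => ?_
  rw [ProbabilityTheory.cdf_eq_real, stdNormalCDF_eq]

theorem tendsto_stdNormalCDF_atTop : Filter.Tendsto stdNormalCDF Filter.atTop (nhds 1) := by
  refine (ProbabilityTheory.tendsto_cdf_atTop (ProbabilityTheory.gaussianReal 0 1)).congr fun x => ?_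
  rw [ProbabilityTheory.cdf_eq_real, stdNormalCDF_eq]

section MonotoneConvergence

open Filter Topology

theorem eventually_lt_uncurry {G : ℕ → ℝ → ℝ} {F : ℝ → ℝ} {l : Filter ℝ} {a y : ℝ}
    (hG : ∀ n, Monotone (G n)) (hGF : Tendsto (fun n => G n y) atTop (𝓝 (F y)))
    (ha : a < F y) (hy : ∀ᶠ z in l, y ≤ z) : ∀ᶠ p : ℕ × ℝ in atTop ×ˢ l, a < G p.1 p.2 :=
  ((hGF.eventually (lt_mem_nhds ha)).prod_mk hy).mono fun p hp => hp.1.trans_le (hG p.1 hp.2)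

theorem eventually_uncurry_lt {G : ℕ → ℝ → ℝ} {F : ℝ → ℝ} {l : Filter ℝ} {a y : ℝ}
    (hG : ∀ n, Monotone (G n)) (hGF : Tendsto (fun n => G n y) atTop (𝓝 (F y)))
    (ha : F y < a) (hy : ∀ᶠ z in l, z ≤ y) : ∀ᶠ p : ℕ × ℝ in atTop ×ˢ l, G p.1 p.2 < a :=
  ((hGF.eventually (gt_mem_nhds ha)).prod_mk hy).mono fun p hp => (hG p.1 hp.2).trans_lt hp.1

/-- Pointwise convergence of monotone functions to a continuous limit is continuous convergence. -/
theorem tendsto_uncurry_of_monotone {G : ℕ → ℝ → ℝ} {F : ℝ → ℝ} (hG : ∀ n, Monotone (G n))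
    (hF : Continuous F) (hGF : ∀ x, Tendsto (fun n => G n x) atTop (𝓝 (F x))) (x : ℝ) :
    Tendsto (fun p : ℕ × ℝ => G p.1 p.2) (atTop ×ˢ 𝓝 x) (𝓝 (F x)) := by
  refine tendsto_order.2 ⟨fun a ha => ?_, fun a ha => ?_⟩
  · obtain ⟨y, hy, hyx⟩ := (((hF.tendsto x).eventually (lt_mem_nhds ha)).filter_mono
      nhdsWithin_le_nhds |>.and (self_mem_nhdsWithin (s := Set.Iio x))).exists
    exact eventually_lt_uncurry hG (hGF y) hy (le_mem_nhds hyx)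
  · obtain ⟨y, hy, hyx⟩ := (((hF.tendsto x).eventually (gt_mem_nhds ha)).filter_mono
      nhdsWithin_le_nhds |>.and (self_mem_nhdsWithin (s := Set.Ioi x))).exists
    exact eventually_uncurry_lt hG (hGF y) hy (ge_mem_nhds hyx)

/-- **Pólya's theorem**: convergence of distribution functions to a continuous distribution
function is uniform. -/
theorem tendsto_iSup_abs_sub_of_monotone {G : ℕ → ℝ → ℝ} {F : ℝ → ℝ}
    (hG : ∀ n, Monotone (G n)) (hG0 : ∀ n x, 0 ≤ G n x) (hG1 : ∀ n x, G n x ≤ 1)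
    (hF : Continuous F) (hF0 : Tendsto F atBot (𝓝 0)) (hF1 : Tendsto F atTop (𝓝 1))
    (hGF : ∀ x, Tendsto (fun n => G n x) atTop (𝓝 (F x))) :
    Tendsto (fun n => ⨆ x, |G n x - F x|) atTop (𝓝 0) := by
  have hbot : Tendsto (fun p : ℕ × ℝ => G p.1 p.2) (atTop ×ˢ atBot) (𝓝 0) := by
    refine tendsto_order.2 ⟨fun a ha => .of_forall fun p => ha.trans_le (hG0 _ _), fun a ha => ?_⟩
    obtain ⟨y, hy⟩ := (hF0.eventually (gt_mem_nhds ha)).exists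
    exact eventually_uncurry_lt hG (hGF y) hy (eventually_le_atBot y)
  have htop : Tendsto (fun p : ℕ × ℝ => G p.1 p.2) (atTop ×ˢ atTop) (𝓝 1) := by
    refine tendsto_order.2 ⟨fun a ha => ?_, fun a ha => .of_forall fun p => (hG1 _ _).trans_lt ha⟩
    obtain ⟨y, hy⟩ := (hF1.eventually (lt_mem_nhds ha)).exists
    exact eventually_lt_uncurry hG (hGF y) hy (eventually_ge_atTop y)
  have hloc (l : Filter ℝ) (L : ℝ) (h : Tendsto (fun p : ℕ × ℝ => G p.1 p.2) (atTop ×ˢ l) (𝓝 L))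
      (h2 : Tendsto F l (𝓝 L)) {ε : ℝ} (hε : 0 < ε) :
      ∃ s ∈ l, ∀ᶠ n in atTop, ∀ x ∈ s, |G n x - F x| < ε := by
    have h3 := (h.sub (h2.comp tendsto_snd)).abs
    rw [sub_self, abs_zero] at h3
    obtain ⟨pa, ha, pb, hb, hab⟩ := eventually_prod_iff.1 (h3.eventually (gt_mem_nhds hε))
    exact ⟨{x | pb x}, hb, ha.mono fun n hn x hx => hab hn hx⟩
  have hunif : ∀ ε : ℝ, 0 < ε → ∀ᶠ n in atTop, ∀ x, |G n x - F x| < ε := by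
    intro ε hε
    obtain ⟨s, hs, hsε⟩ := hloc _ _ hbot hF0 hε
    obtain ⟨t, ht, htε⟩ := hloc _ _ htop hF1 hε
    obtain ⟨a, ha⟩ := mem_atBot_sets.1 hs
    obtain ⟨b, hb⟩ := mem_atTop_sets.1 ht
    have hK : ∀ᶠ n in atTop, ∀ x ∈ Set.Icc a b, |G n x - F x| < ε := by
      refine isCompact_Icc.induction_on (p := fun s => ∀ᶠ n in atTop, ∀ x ∈ s, |G n x - F x| < ε)
        (by simp) (fun s t hst ht => ht.mono fun n hn x hx => hn x (hst hx))
        (fun s t hs ht => ?_) fun x _ => ?_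
      · filter_upwards [hs, ht] with n h1 h2 x hx
        exact hx.elim (h1 x) (h2 x)
      · obtain ⟨s, hs, h⟩ :=
          hloc _ _ (tendsto_uncurry_of_monotone hG hF hGF x) (hF.tendsto x) hε
        exact ⟨s, nhdsWithin_le_nhds hs, h⟩
    filter_upwards [hsε, htε, hK] with n h1 h2 h3 x
    rcases le_total x a with hx | hx
    · exact h1 x (ha x hx)
    rcases le_total b x with hx' | hx'
    · exact h2 x (hb x hx')
    exact h3 x ⟨hx, hx'⟩
  refine tendsto_order.2 ⟨fun a ha => .of_forall fun n =>
    ha.trans_le (Real.iSup_nonneg fun x => abs_nonneg _), fun a ha => ?_⟩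
  filter_upwards [hunif (a / 2) (half_pos ha)] with n hn
  exact (ciSup_le fun x => (hn x).le).trans_lt (half_lt_self ha)

end MonotoneConvergence

/-! ### Asymptotic normality -/

namespace IsEulerianHalf

variable {c : ℕ → ℕ → ℕ} {ε : ℝ}

theorem summable_ite (h : IsEulerianHalf c ε) (n : ℕ) (y : ℝ) :
    Summable fun k : ℕ => if (k : ℝ) ≤ y then (c n k : ℝ) else 0 := by
  refine summable_of_hasFiniteSupport ((h.finite_support n).subset fun k hk => ?_)
  simp only [Function.mem_support] at hk ⊢
  contrapose! hk
  simp [hk]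

theorem monotone_rowCDF (h : IsEulerianHalf c ε) (n : ℕ) : Monotone (rowCDF c n) := by
  intro y z hyz
  refine div_le_div_of_nonneg_right ?_ (tsum_nonneg fun k => Nat.cast_nonneg _)
  refine (h.summable_ite n y).tsum_le_tsum (fun k => ?_) (h.summable_ite n z)
  split_ifs <;> linarith [(c n k).cast_nonneg (α := ℝ)]

theorem rowCDF_nonneg (c : ℕ → ℕ → ℕ) (n : ℕ) (y : ℝ) : 0 ≤ rowCDF c n y :=
  div_nonneg (tsum_nonneg fun k => by positivity) (tsum_nonneg fun k => Nat.cast_nonneg _)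

theorem rowCDF_le_one (h : IsEulerianHalf c ε) (n : ℕ) (y : ℝ) : rowCDF c n y ≤ 1 := by
  refine div_le_one_of_le₀ ?_ (tsum_nonneg fun k => Nat.cast_nonneg _)
  refine (h.summable_ite n y).tsum_le_tsum (fun k => ?_)
    (summable_of_hasFiniteSupport (h.finite_support n))
  split_ifs
  · rfl
  · positivity

theorem abs_rowCDF_sub_le (h : IsEulerianHalf c ε) {n : ℕ} (hn : 1 ≤ n) (y : ℝ) :
    |rowCDF c n y - irwinHall n (⌊y⌋ + 1 / 2)| ≤ 1 / n.factorial := by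
  have h1 : ∀ k : ℕ, (if (k : ℝ) ≤ y then (c n k : ℝ) else 0) =
      (if (k : ℤ) ≤ ⌊y⌋ then 1 else 0) * (c n k : ℝ) := by
    intro k
    simp [Int.le_floor]
  have h2 : |altSum n fun k => if (k : ℤ) ≤ ⌊y⌋ then 1 else 0| ≤ 2 ^ n * 1 :=
    abs_altSum_le n fun k => by split_ifs <;> simp
  have hf : (0 : ℝ) < n.factorial := by positivity
  rw [rowCDF, h.rowSum_eq hn, tsum_congr h1, h.tsum_mul, eulerSum_indicator]
  set A := altSum n fun k => if (k : ℤ) ≤ ⌊y⌋ then 1 else 0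
  have h3 : (2 ^ n * n.factorial * irwinHall n (⌊y⌋ + 1 / 2) + ε * A) / 2 /
      (2 ^ n * n.factorial / 2) - irwinHall n (⌊y⌋ + 1 / 2) = ε * A / (2 ^ n * n.factorial) := by
    field_simp
    ring
  rw [h3, abs_div, abs_mul, h.abs_eq, one_mul, abs_of_pos (a := 2 ^ n * (n.factorial : ℝ)) (by positivity),
    div_le_div_iff₀ (by positivity) hf]
  nlinarith

open Filter Topology in
theorem tendsto_rowCDF (h : IsEulerianHalf c ε) (x : ℝ) :
    Tendsto (fun n => rowCDF c n (x * √(rowVar c n) + rowMean c n)) atTop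
      (𝓝 (stdNormalCDF x)) := by
  set y : ℕ → ℝ := fun n => x * √(((n : ℝ) + 1) / 12) + n / 2
  set z : ℕ → ℝ := fun n => (⌊y n⌋ + 1 / 2 - n / 2) / √(n / 12)
  have hsqrt : Tendsto (fun n : ℕ => √((n : ℝ) / 12)) atTop atTop :=
    Real.tendsto_sqrt_atTop.comp (tendsto_natCast_atTop_atTop.atTop_div_const (by norm_num))
  have hz : Tendsto z atTop (𝓝 x) := by
    have h1 : Tendsto (fun n : ℕ => x * √(1 + 1 / (n : ℝ))) atTop (𝓝 x) := by
      have := (Real.continuous_sqrt.tendsto _).comp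
        (tendsto_const_nhds (x := (1 : ℝ)).add tendsto_one_div_atTop_nhds_zero_nat)
      simpa using this.const_mul x
    have h2 : Tendsto (fun n : ℕ => (1 / 2 - Int.fract (y n)) / √((n : ℝ) / 12)) atTop (𝓝 0) := by
      refine squeeze_zero_norm (a := fun n : ℕ => 1 / √((n : ℝ) / 12)) (fun n => ?_)
        (tendsto_const_nhds.div_atTop hsqrt)
      rw [norm_div, Real.norm_of_nonneg (Real.sqrt_nonneg _)]
      refine div_le_div_of_nonneg_right ?_ (Real.sqrt_nonneg _)
      rw [Real.norm_eq_abs, abs_le]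
      constructor <;> linarith [Int.fract_nonneg (y n), Int.fract_lt_one (y n)]
    have h3 := h1.add h2
    rw [add_zero] at h3
    refine h3.congr' ?_
    filter_upwards [eventually_gt_atTop 0] with n hn
    have hn' : (0 : ℝ) < n := by exact_mod_cast hn
    have hs : 0 < √((n : ℝ) / 12) := by positivity
    have h4 : √(((n : ℝ) + 1) / 12) = √(1 + 1 / (n : ℝ)) * √((n : ℝ) / 12) := by
      rw [← Real.sqrt_mul (by positivity)]
      congr 1
      field_simp
    have h5 : (⌊y n⌋ : ℝ) = y n - Int.fract (y n) := by
      rw [← Int.floor_add_fract (y n)]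
      simp
    simp only [z]
    rw [h5]
    simp only [y]
    rw [h4]
    field_simp
    ring
  have hG : ∀ n : ℕ, Monotone fun u : ℝ => irwinHall n (n / 2 + u * √(n / 12)) := fun n u v huv =>
    monotone_irwinHall n (by gcongr)
  have h1 := (tendsto_uncurry_of_monotone hG continuous_stdNormalCDF tendsto_irwinHall x).comp
    (tendsto_id.prodMk hz)
  have h2 : Tendsto (fun n => rowCDF c n (y n) - irwinHall n (⌊y n⌋ + 1 / 2)) atTop (𝓝 0) := by
    refine squeeze_zero_norm' (a := fun n : ℕ => 1 / (n : ℝ)) ?_ tendsto_one_div_atTop_nhds_zero_nat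
    filter_upwards [eventually_ge_atTop 1] with n hn
    refine (h.abs_rowCDF_sub_le hn (y n)).trans ?_
    exact one_div_le_one_div_of_le (by exact_mod_cast hn)
      (by exact_mod_cast Nat.self_le_factorial n)
  have h3 := h1.add h2
  rw [add_zero] at h3
  refine h3.congr' ?_
  filter_upwards [eventually_ge_atTop 3] with n hn
  have hn' : (0 : ℝ) < n := by exact_mod_cast (by omega : 0 < n)
  have hs : 0 < √((n : ℝ) / 12) := by positivity
  have h4 : (n : ℝ) / 2 + z n * √(n / 12) = ⌊y n⌋ + 1 / 2 := by
    simp only [z]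
    rw [div_mul_cancel₀ _ hs.ne']
    ring
  simp only [Function.comp, id]
  rw [h4, h.rowMean_eq (by omega), h.rowVar_eq hn]
  ring

theorem isAsympNormal (h : IsEulerianHalf c ε) : IsAsympNormal c :=
  tendsto_iSup_abs_sub_of_monotone
    (fun n u v huv => h.monotone_rowCDF n (by gcongr))
    (fun n x => rowCDF_nonneg c n _) (fun n x => h.rowCDF_le_one n _)
    continuous_stdNormalCDF tendsto_stdNormalCDF_atBot tendsto_stdNormalCDF_atTop
    h.tendsto_rowCDF

end IsEulerianHalf

/-- Theorem: the coefficients of `BExc_n^±(t)` (and of `B_n^±(t)`) are asymptotically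
normal; for `n ≥ 2` the mean is `n/2` and for `n ≥ 3` the variance is `(n+1)/12`. -/
theorem typeB_clt_exc_plus_minus :
    IsAsympNormal cBExcP ∧ IsAsympNormal cBExcM ∧
    IsAsympNormal cBDesP ∧ IsAsympNormal cBDesM ∧
    (∀ n : ℕ, 2 ≤ n →
      rowMean cBExcP n = (n : ℝ) / 2 ∧ rowMean cBExcM n = (n : ℝ) / 2 ∧
      rowMean cBDesP n = (n : ℝ) / 2 ∧ rowMean cBDesM n = (n : ℝ) / 2) ∧
    (∀ n : ℕ, 3 ≤ n →
      rowVar cBExcP n = ((n : ℝ) + 1) / 12 ∧ rowVar cBExcM n = ((n : ℝ) + 1) / 12 ∧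
      rowVar cBDesP n = ((n : ℝ) + 1) / 12 ∧ rowVar cBDesM n = ((n : ℝ) + 1) / 12) :=
  ⟨isEulerianHalf_cBExcP.isAsympNormal, isEulerianHalf_cBExcM.isAsympNormal,
    isEulerianHalf_cBDesP.isAsympNormal, isEulerianHalf_cBDesM.isAsympNormal,
    fun _ hn => ⟨isEulerianHalf_cBExcP.rowMean_eq hn, isEulerianHalf_cBExcM.rowMean_eq hn,
      isEulerianHalf_cBDesP.rowMean_eq hn, isEulerianHalf_cBDesM.rowMean_eq hn⟩,
    fun _ hn => ⟨isEulerianHalf_cBExcP.rowVar_eq hn, isEulerianHalf_cBExcM.rowVar_eq hn,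
      isEulerianHalf_cBDesP.rowVar_eq hn, isEulerianHalf_cBDesM.rowVar_eq hn⟩⟩
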